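/- (Gas–liquid interaction model.) Let σ₁, σ₂, ρ₁ > 0 and take v_α ≡ 0, so that 𝓛_α is the pure diffusion operator. Let f₁(u₁,u₂) = −σ₁(ρ₁ − u₁)u₂ and f₂(u₁,u₂) = σ₂(ρ₁ − u₁)u₂. Let the boundary data satisfy 0 ≤ g₁*(i,j) ≤ ρ₁ and g₂(i,j) ≥ 0 at all boundary points. Let W₁ and W₂ be mesh functions satisfying 𝓛₁W₁(i,j) = 0 at interior points with W₁ = g₁* on the boundary, and 𝓛₂W₂(i,j) = 0 at interior points with W₂ = g₂ on the boundary. Then Ũ = (ρ₁, W₂) (first component constantly ρ₁) and Û = (W₁, 0) (second component identically zero) are ordered upper and lower solutions of the nonlinear difference scheme 𝓛_α U_α(i,j) + f_α(U₁(i,j),U₂(i,j)) = 0 at interior points, U₁ = g₁*, U₂ = g₂ on the boundary; in particular W₁(i,j) ≤ ρ₁ and W₂(i,j) ≥ 0 at every mesh point. -/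

import Mathlib

namespace BlockMonotone

/-- A rectangular mesh on the unit square with `Nx, Ny ≥ 2` subdivisions. -/
structure Mesh where
  Nx : ℕ
  Ny : ℕ
  hNx : 2 ≤ Nx
  hNy : 2 ≤ Ny

namespace Mesh

variable (M : Mesh)

/-- Mesh spacing in the x-direction. -/
noncomputable def hx : ℝ := 1 / (M.Nx : ℝ)

/-- Mesh spacing in the y-direction. -/
noncomputable def hy : ℝ := 1 / (M.Ny : ℝ)

/-- `(i,j)` is a mesh point. -/
def IsMeshPt (i j : ℕ) : Prop := i ≤ M.Nx ∧ j ≤ M.Ny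

/-- `(i,j)` is an interior mesh point. -/
def IsInterior (i j : ℕ) : Prop := 1 ≤ i ∧ i ≤ M.Nx - 1 ∧ 1 ≤ j ∧ j ≤ M.Ny - 1

/-- `(i,j)` is a boundary mesh point. -/
def IsBoundary (i j : ℕ) : Prop := M.IsMeshPt i j ∧ ¬ M.IsInterior i j

/-- Coefficient `l_α(i,j) = ε/hx² + v(i,j)/hx`. -/
noncomputable def lC (ε : ℝ) (v : ℕ → ℕ → ℝ) (i j : ℕ) : ℝ := ε / M.hx ^ 2 + v i j / M.hx

/-- Coefficient `r_α(i,j) = ε/hx²`. -/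
noncomputable def rC (ε : ℝ) : ℝ := ε / M.hx ^ 2

/-- Coefficient `b_α(i,j) = ε/hy² + v(i,j)/hy`. -/
noncomputable def bC (ε : ℝ) (v : ℕ → ℕ → ℝ) (i j : ℕ) : ℝ := ε / M.hy ^ 2 + v i j / M.hy

/-- Coefficient `t_α(i,j) = ε/hy²`. -/
noncomputable def tC (ε : ℝ) : ℝ := ε / M.hy ^ 2

/-- Coefficient `d_α(i,j) = l + r + b + t`. -/
noncomputable def dC (ε : ℝ) (v : ℕ → ℕ → ℝ) (i j : ℕ) : ℝ :=
  M.lC ε v i j + M.rC ε + M.bC ε v i j + M.tC ε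

/-- The discrete operator `𝓛 U(i,j)` at interior points. -/
noncomputable def discL (ε : ℝ) (v : ℕ → ℕ → ℝ) (U : ℕ → ℕ → ℝ) (i j : ℕ) : ℝ :=
  M.dC ε v i j * U i j - M.lC ε v i j * U (i - 1) j - M.rC ε * U (i + 1) j
    - M.bC ε v i j * U i (j - 1) - M.tC ε * U i (j + 1)

end Mesh

/-- Partial derivative of a two-variable real function in its first variable. -/
noncomputable def p1 (f : ℝ → ℝ → ℝ) (u₁ u₂ : ℝ) : ℝ := deriv (fun x => f x u₂) u₁

/-- Partial derivative of a two-variable real function in its second variable. -/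
noncomputable def p2 (f : ℝ → ℝ → ℝ) (u₁ u₂ : ℝ) : ℝ := deriv (fun y => f u₁ y) u₂

end BlockMonotone

open BlockMonotone

/-- Reaction function f₁(u₁,u₂) = −σ₁(ρ₁ − u₁)u₂ of the gas–liquid interaction
model. -/
def glF1 (σ₁ ρ₁ u₁ u₂ : ℝ) : ℝ := -(σ₁ * (ρ₁ - u₁) * u₂)

/-- Reaction function f₂(u₁,u₂) = σ₂(ρ₁ − u₁)u₂ of the gas–liquid interaction
model. -/
def glF2 (σ₂ ρ₁ u₁ u₂ : ℝ) : ℝ := σ₂ * (ρ₁ - u₁) * u₂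

namespace BlockMonotone.Mesh

variable (M : Mesh)

lemma hx_pos : 0 < M.hx :=
  one_div_pos.2 (Nat.cast_pos.2 (lt_of_lt_of_le two_pos M.hNx))

lemma hy_pos : 0 < M.hy :=
  one_div_pos.2 (Nat.cast_pos.2 (lt_of_lt_of_le two_pos M.hNy))

lemma discL_const (ε : ℝ) (v : ℕ → ℕ → ℝ) (c : ℝ) (i j : ℕ) :
    M.discL ε v (fun _ _ => c) i j = 0 := by
  unfold discL dC
  ring

lemma discL_const_sub (ε : ℝ) (v : ℕ → ℕ → ℝ) (c : ℝ) (U : ℕ → ℕ → ℝ) (i j : ℕ) :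
    M.discL ε v (fun i j => c - U i j) i j = -M.discL ε v U i j := by
  unfold discL dC
  ring

/-- At a minimum of a supersolution over a mesh stencil, the left neighbour attains the same
value. -/
lemma left_eq_of_le_neighbours {ε : ℝ} (hε : 0 < ε) {v : ℕ → ℕ → ℝ} {U : ℕ → ℕ → ℝ} {i j : ℕ}
    (hv : 0 ≤ v i j) (hL : 0 ≤ M.discL ε v U i j)
    (hl : U i j ≤ U (i - 1) j) (hr : U i j ≤ U (i + 1) j)
    (hb : U i j ≤ U i (j - 1)) (ht : U i j ≤ U i (j + 1)) :
    U (i - 1) j = U i j := by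
  have hx := M.hx_pos
  have hy := M.hy_pos
  have hl0 : 0 < M.lC ε v i j := by unfold lC; positivity
  have hr0 : 0 ≤ M.rC ε := by unfold rC; positivity
  have hb0 : 0 ≤ M.bC ε v i j := by unfold bC; positivity
  have ht0 : 0 ≤ M.tC ε := by unfold tC; positivity
  have key : M.lC ε v i j * (U (i - 1) j - U i j) ≤ 0 := by
    unfold discL dC at hL
    linarith [mul_nonneg hr0 (sub_nonneg.2 hr), mul_nonneg hb0 (sub_nonneg.2 hb),
      mul_nonneg ht0 (sub_nonneg.2 ht)]
  exact le_antisymm (sub_nonpos.1 (nonpos_of_mul_nonpos_right key hl0)) hl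

/-- Discrete minimum principle: a mesh function with `𝓛 U ≥ 0` at interior points and `U ≥ 0` on
the boundary is nonnegative at all mesh points. -/
theorem nonneg_of_discL_nonneg {ε : ℝ} (hε : 0 < ε) {v : ℕ → ℕ → ℝ} {U : ℕ → ℕ → ℝ}
    (hv : ∀ i j, M.IsInterior i j → 0 ≤ v i j)
    (hL : ∀ i j, M.IsInterior i j → 0 ≤ M.discL ε v U i j)
    (hbd : ∀ i j, M.IsBoundary i j → 0 ≤ U i j) {i j : ℕ} (hij : M.IsMeshPt i j) :
    0 ≤ U i j := by
  obtain ⟨⟨a, b⟩, hab, hmin⟩ := Finset.exists_min_image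
    (Finset.range (M.Nx + 1) ×ˢ Finset.range (M.Ny + 1)) (fun p => U p.1 p.2) ⟨(0, 0), by simp⟩
  simp only [Finset.mem_product, Finset.mem_range, Nat.lt_succ_iff, Prod.forall] at hab hmin
  refine le_trans ?_ (hmin i j hij)
  have attained : ∀ k ≤ M.Nx, U k b = U a b → 0 ≤ U a b := by
    intro k
    induction k with
    | zero =>
      intro hk h
      exact h ▸ hbd 0 b ⟨⟨hk, hab.2⟩, fun h0 => absurd h0.1 (by omega)⟩
    | succ k ih =>
      intro hk h
      by_cases hint : M.IsInterior (k + 1) b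
      · have hint' := hint
        obtain ⟨-, h2, h3, h4⟩ := hint'
        refine ih (by omega) (Eq.trans ?_ h)
        refine M.left_eq_of_le_neighbours hε (hv _ _ hint) (hL _ _ hint) ?_ ?_ ?_ ?_ <;>
          exact h ▸ hmin _ _ ⟨by omega, by omega⟩
      · exact h ▸ hbd _ _ ⟨⟨hk, hab.2⟩, hint⟩
  exact attained a hab.1 rfl

end BlockMonotone.Mesh

/-- Construction of ordered upper and lower solutions Ũ = (ρ₁, W₂), Û = (W₁, 0)
for the discrete gas–liquid interaction model (pure diffusion, v ≡ 0). -/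
theorem gas_liquid_initial_solutions (M : Mesh)
    (ε : Fin 2 → ℝ) (hε : ∀ a, 0 < ε a)
    (σ₁ σ₂ ρ₁ : ℝ) (hσ₁ : 0 < σ₁) (hσ₂ : 0 < σ₂) (hρ₁ : 0 < ρ₁)
    (g1star g2 : ℕ → ℕ → ℝ)
    (hg1 : ∀ i j, M.IsBoundary i j → 0 ≤ g1star i j ∧ g1star i j ≤ ρ₁)
    (hg2 : ∀ i j, M.IsBoundary i j → 0 ≤ g2 i j)
    (W1 W2 : ℕ → ℕ → ℝ)
    (hW1 : ∀ i j, M.IsInterior i j → M.discL (ε 0) (fun _ _ => 0) W1 i j = 0)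
    (hW1bd : ∀ i j, M.IsBoundary i j → W1 i j = g1star i j)
    (hW2 : ∀ i j, M.IsInterior i j → M.discL (ε 1) (fun _ _ => 0) W2 i j = 0)
    (hW2bd : ∀ i j, M.IsBoundary i j → W2 i j = g2 i j) :
    (∀ i j, M.IsMeshPt i j → W1 i j ≤ ρ₁ ∧ 0 ≤ W2 i j)
    ∧ (∀ i j, M.IsInterior i j →
        0 ≤ M.discL (ε 0) (fun _ _ => 0) (fun _ _ => ρ₁) i j + glF1 σ₁ ρ₁ ρ₁ (W2 i j))
    ∧ (∀ i j, M.IsInterior i j →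
        0 ≤ M.discL (ε 1) (fun _ _ => 0) W2 i j + glF2 σ₂ ρ₁ ρ₁ (W2 i j))
    ∧ (∀ i j, M.IsInterior i j →
        M.discL (ε 0) (fun _ _ => 0) W1 i j + glF1 σ₁ ρ₁ (W1 i j) 0 ≤ 0)
    ∧ (∀ i j, M.IsInterior i j →
        M.discL (ε 1) (fun _ _ => 0) (fun _ _ => (0 : ℝ)) i j
          + glF2 σ₂ ρ₁ (W1 i j) 0 ≤ 0)
    ∧ (∀ i j, M.IsBoundary i j → W1 i j ≤ g1star i j ∧ g1star i j ≤ ρ₁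
        ∧ (0 : ℝ) ≤ g2 i j ∧ g2 i j ≤ W2 i j) := by
  have hρW1 : ∀ i j, M.IsMeshPt i j → W1 i j ≤ ρ₁ := fun i j hij =>
    sub_nonneg.1 <| M.nonneg_of_discL_nonneg (U := fun i j => ρ₁ - W1 i j) (hε 0)
      (fun _ _ _ => le_rfl)
      (fun i j h => by rw [M.discL_const_sub, hW1 i j h, neg_zero])
      (fun i j h => by rw [hW1bd i j h]; exact sub_nonneg.2 (hg1 i j h).2) hij
  have hW2nonneg : ∀ i j, M.IsMeshPt i j → 0 ≤ W2 i j := fun i j hij =>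
    M.nonneg_of_discL_nonneg (hε 1) (fun _ _ _ => le_rfl) (fun i j h => (hW2 i j h).ge)
      (fun i j h => by rw [hW2bd i j h]; exact hg2 i j h) hij
  refine ⟨fun i j h => ⟨hρW1 i j h, hW2nonneg i j h⟩, fun i j _ => ?_, fun i j h => ?_,
    fun i j h => ?_, fun i j _ => ?_, fun i j h => ⟨(hW1bd i j h).le, (hg1 i j h).2, hg2 i j h,
    (hW2bd i j h).ge⟩⟩
  · simp [M.discL_const, glF1]
  · simp [hW2 i j h, glF2]
  · simp [hW1 i j h, glF1]
  · simp [M.discL_const, glF2]
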